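/- (Level lemma for double negation in M_{IL_p}.) For every k ≥ 0 and every formula α: if every valuation w ∈ L_k assigns T to α, then every valuation v ∈ L_{k+1} assigns T to ¬¬α. -/

import Mathlib

/-- Formulas of intuitionistic propositional logic. -/
inductive IForm : Type where
  | atom : ℕ → IForm
  | bot : IForm
  | top : IForm
  | neg : IForm → IForm
  | imp : IForm → IForm → IForm
  | conj : IForm → IForm → IForm
  | disj : IForm → IForm → IForm
deriving DecidableEq

/-- Multifunction for negation in `M_{ILp}`: `¬̃F = {F, T}`, `¬̃T = {F}`.
(`true` is the value `T`, `false` is `F`.) -/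
def INeg : Bool → Set Bool
  | false => Set.univ
  | true => {false}

/-- Multifunction for implication in `M_{ILp}`. -/
def IImp : Bool → Bool → Set Bool
  | false, false => Set.univ
  | false, true => {true}
  | true, false => {false}
  | true, true => {true}

/-- `v ∈ Val(M_{ILp})`. -/
def IIsVal (v : IForm → Bool) : Prop :=
  v IForm.bot = false ∧ v IForm.top = true ∧
  (∀ a, v (IForm.neg a) ∈ INeg (v a)) ∧
  (∀ a b, v (IForm.imp a b) ∈ IImp (v a) (v b)) ∧
  (∀ a b, v (IForm.conj a b) = (v a && v b)) ∧
  (∀ a b, v (IForm.disj a b) = (v a || v b))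

/-- The levels `L_k` of valuations of `M_{ILp}`. -/
def ILev : ℕ → Set (IForm → Bool)
  | 0 => {v | IIsVal v}
  | k + 1 => {v | v ∈ ILev k ∧
      (∀ a b, v a = false → v b = false → v (IForm.imp a b) = false →
        ∃ w ∈ ILev k, w a = true ∧ w b = false ∧ ∀ c, v c = true → w c = true) ∧
      (∀ a, v a = false → v (IForm.neg a) = false →
        ∃ w ∈ ILev k, w a = true ∧ ∀ c, v c = true → w c = true)}

/-- `L^{ILp} = ⋂_k L_k`, the restricted set of valuations of the RNmatrix for `ILp`. -/
def ILimit : Set (IForm → Bool) := {v | ∀ k, v ∈ ILev k}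

theorem IIsVal_of_mem_ILev {k : ℕ} {v : IForm → Bool} (hv : v ∈ ILev k) : IIsVal v := by
  induction k with
  | zero => exact hv
  | succ k ih => exact ih hv.1

theorem IIsVal.neg_eq_false {v : IForm → Bool} (hv : IIsVal v) {a : IForm} (ha : v a = true) :
    v (IForm.neg a) = false := by
  simpa [ha, INeg] using hv.2.2.1 a

theorem level_lemma_double_negation (k : ℕ) (a : IForm)
    (h : ∀ w ∈ ILev k, w a = true) :
    ∀ v ∈ ILev (k + 1), v (IForm.neg (IForm.neg a)) = true := by
  intro v hv
  by_contra hnn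
  have neg_false (w) (hw : w ∈ ILev k) : w (IForm.neg a) = false :=
    (IIsVal_of_mem_ILev hw).neg_eq_false (h w hw)
  obtain ⟨w, hw, hwt, -⟩ := hv.2.2 _ (neg_false v hv.1) (Bool.eq_false_of_not_eq_true hnn)
  exact Bool.false_ne_true ((neg_false w hw).symm.trans hwt)
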